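/- For every integer n ≥ 10, the online size Ramsey number satisfies r̃(P_4, P_n) ≤ ⌈7n/5⌉ − 1. -/

import Mathlib

namespace OSR

/-- A partial red/blue colouring of the edges of the complete graph on `ℕ`:
`some true` = red, `some false` = blue, `none` = unselected. -/
abbrev Coloring := Sym2 ℕ → Option Bool

/-- The colouring `C` contains a monochromatic path of colour `c` on `k` vertices. -/
def HasPath (C : Coloring) (c : Bool) (k : ℕ) : Prop :=
  ∃ f : Fin k → ℕ, Function.Injective f ∧
    ∀ i j : Fin k, (j : ℕ) = (i : ℕ) + 1 → C s(f i, f j) = some c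

/-- A Builder strategy: given the current position, select an edge. -/
abbrev BuilderStrat := Coloring → Sym2 ℕ

/-- A Painter strategy: given the current position and the selected edge,
choose a colour (`true` = red, `false` = blue). -/
abbrev PainterStrat := Coloring → Sym2 ℕ → Bool

/-- The position after `t` rounds of play, starting from `C0`. -/
def play (C0 : Coloring) (B : BuilderStrat) (P : PainterStrat) : ℕ → Coloring
  | 0 => C0
  | t + 1 =>
    Function.update (play C0 B P t) (B (play C0 B P t))
      (some (P (play C0 B P t) (B (play C0 B P t))))

/-- Builder plays legally: he always selects a previously unselected non-loop edge. -/
def BuilderOK (C0 : Coloring) (B : BuilderStrat) : Prop :=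
  ∀ (P : PainterStrat) (t : ℕ),
    play C0 B P t (B (play C0 B P t)) = none ∧ ¬(B (play C0 B P t)).IsDiag

/-- The empty position: no edge has been coloured. -/
def emptyCol : Coloring := fun _ => none

/-- The online Ramsey game for `(P_k, P_n)` has ended: there is a red path on `k`
vertices or a blue path on `n` vertices. -/
def Ends (k n : ℕ) (C : Coloring) : Prop := HasPath C true k ∨ HasPath C false n

/-- The online size Ramsey number `r̃(P_k, P_n)`: the least `t` such that Builder
has a strategy forcing, against every Painter, a red `P_k` or a blue `P_n`
within at most `t` rounds. -/
noncomputable def onlineRamseyPath (k n : ℕ) : ℕ :=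
  sInf {t : ℕ | ∃ B : BuilderStrat, BuilderOK emptyCol B ∧
    ∀ P : PainterStrat, ∃ s ≤ t, Ends k n (play emptyCol B P s)}

/-- Painter plays legally in the game `RR_H(P_k, ⬝)`: he never colours an edge red
if that would create a red path on `k` vertices. -/
def PainterOK (k : ℕ) (P : PainterStrat) : Prop :=
  ∀ (C : Coloring) (e : Sym2 ℕ),
    ¬HasPath C true k → HasPath (Function.update C e (some true)) true k →
      P C e = false

/-- The colour `c` is an allowed answer of Painter on the edge `e` in position `C`
of the game `RR(P_k, ⬝)`. -/
def Allowed (k : ℕ) (C : Coloring) (e : Sym2 ℕ) (c : Bool) : Prop :=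
  c = true → ¬HasPath C true k → ¬HasPath (Function.update C e (some true)) true k

/-- One round in the variant where Builder may reselect an already coloured edge,
in which case it keeps its colour. -/
def stepR (C : Coloring) (e : Sym2 ℕ) (c : Bool) : Coloring :=
  if C e = none then Function.update C e (some c) else C

/-- The position after `t` rounds, in the variant where a reselected edge keeps
its colour (and the round still counts). -/
def playR (C0 : Coloring) (B : BuilderStrat) (P : PainterStrat) : ℕ → Coloring
  | 0 => C0
  | t + 1 =>
    stepR (playR C0 B P t) (B (playR C0 B P t))
      (P (playR C0 B P t) (B (playR C0 B P t)))

/-- Builder plays legally in the reselection variant: he selects non-loop edges. -/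
def BuilderOKR (C0 : Coloring) (B : BuilderStrat) : Prop :=
  ∀ (P : PainterStrat) (t : ℕ), ¬(B (playR C0 B P t)).IsDiag

/-- Consecutive members of `l` are joined by blue edges. -/
def BlueChain (C : Coloring) (l : List ℕ) : Prop :=
  l.Chain' fun a b => C s(a, b) = some false

/-- Consecutive members of `l` are joined by red edges. -/
def RedChain (C : Coloring) (l : List ℕ) : Prop :=
  l.Chain' fun a b => C s(a, b) = some true

/-- `l` is the vertex sequence of a blue path (on at least one vertex) in `C`. -/
def IsBluePath (C : Coloring) (l : List ℕ) : Prop :=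
  l ≠ [] ∧ l.Nodup ∧ BlueChain C l

/-- `l` is the vertex sequence of a red path (on at least one vertex) in `C`. -/
def IsRedPath (C : Coloring) (l : List ℕ) : Prop :=
  l ≠ [] ∧ l.Nodup ∧ RedChain C l

/-- `x` is an end of the path with vertex sequence `l`. -/
def IsEnd (x : ℕ) (l : List ℕ) : Prop :=
  l.head? = some x ∨ l.getLast? = some x

/-- `e` joins two consecutive vertices of `l`, i.e. `e` is an edge of the path `l`. -/
def IsPathEdge (l : List ℕ) (e : Sym2 ℕ) : Prop :=
  ∃ (i : ℕ) (h : i + 1 < l.length),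
    e = s(l.get ⟨i, Nat.lt_of_succ_lt h⟩, l.get ⟨i + 1, h⟩)

/-- The paths of the family `G` are pairwise vertex-disjoint. -/
def DisjFam {s : ℕ} (G : Fin s → List ℕ) : Prop :=
  ∀ i j, i ≠ j → ∀ x, x ∈ G i → x ∉ G j

/-- `C` contains `T` pairwise vertex-disjoint blue paths of length 2
(i.e. on 3 vertices each). -/
def HasDisjointBluePaths3 (C : Coloring) (T : ℕ) : Prop :=
  ∃ G : Fin T → List ℕ,
    (∀ i, (G i).length = 3 ∧ IsBluePath C (G i)) ∧ DisjFam G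

/-- `(G, u)` witnesses that `C` contains an essential `(s,d,m)`-graph:
`G` lists the `s` pairwise disjoint nonempty essential blue paths,
`u` lists the vertices of the essential red path, `u i` being an end of `G i`,
and the blue paths have `m` vertices in total. -/
def IsEssWitness (C : Coloring) (s d m : ℕ)
    (G : Fin s → List ℕ) (u : Fin d → ℕ) : Prop :=
  (∀ i, IsBluePath C (G i)) ∧ DisjFam G ∧
  Function.Injective u ∧
  (∀ i j : Fin d, (j : ℕ) = (i : ℕ) + 1 → C s(u i, u j) = some true) ∧
  (∀ (i : Fin d) (h : (i : ℕ) < s), IsEnd (u i) (G ⟨i, h⟩)) ∧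
  (∑ i, (G i).length) = m

/-- `C` contains an essential `(s,d,m)`-graph. -/
def IsEssGraph (C : Coloring) (s d m : ℕ) : Prop :=
  d ≤ s ∧ ∃ (G : Fin s → List ℕ) (u : Fin d → ℕ), IsEssWitness C s d m G u

/-- `C` contains an `(s,d,m)`-fence: a red picket `R` on `d` vertices whose last
vertex is the first vertex of the blue picket `G 0`, further pairwise disjoint
nonempty blue pickets `G 1, …`, the blue pickets having `m` vertices in total. -/
def IsFence (C : Coloring) (s d m : ℕ) : Prop :=
  ∃ (hs : 0 < s) (R : List ℕ) (G : Fin s → List ℕ),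
    R.length = d ∧ IsRedPath C R ∧
    (∀ i, IsBluePath C (G i)) ∧ DisjFam G ∧
    R.getLast? = (G ⟨0, hs⟩).head? ∧
    (∀ x ∈ R.dropLast, ∀ i, x ∉ G i) ∧
    (∑ i, (G i).length) = m

/-- There is a red path of length `len` (i.e. on `len + 1` vertices) with end `x`. -/
def RedTailAt (C : Coloring) (x : ℕ) (len : ℕ) : Prop :=
  ∃ l : List ℕ, l.length = len + 1 ∧ l.head? = some x ∧ IsRedPath C l

/-- `l` is a blue `(1,1)`-path: a blue path such that each of its two ends is an
end of a red path of length 1. -/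
def IsBlue11Path (C : Coloring) (l : List ℕ) : Prop :=
  IsBluePath C l ∧
  (∀ x, l.head? = some x → RedTailAt C x 1) ∧
  (∀ x, l.getLast? = some x → RedTailAt C x 1)

/-- `l = [u_1, …, u_k, u_{k+1}]` is an extended `(2,0)`-path: `k ≥ 2`, the edge
`u_k u_{k+1}` is red and `u_1 … u_k` is a blue `(2,0)`-path with `2`-end `u_k`
(its blue end is `u_1`, its transition vertex `u_k`, its red end `u_{k+1}`). -/
def IsExtPath (C : Coloring) (l : List ℕ) : Prop :=
  3 ≤ l.length ∧ l.Nodup ∧ BlueChain C l.dropLast ∧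
  ∀ a b, l.dropLast.getLast? = some a → l.getLast? = some b →
    C s(a, b) = some true ∧ RedTailAt C a 2

/-- The vertices `x 0, …, x 4` form a limb in `C`: blue edges `x0x1`, `x2x3`,
`x1x4` and a red edge `x1x2` (paper notation: blue `x1x2, x3x4, x2x5`, red `x2x3`). -/
def IsLimb (C : Coloring) (x : Fin 5 → ℕ) : Prop :=
  Function.Injective x ∧
  C s(x 0, x 1) = some false ∧ C s(x 2, x 3) = some false ∧
  C s(x 1, x 4) = some false ∧ C s(x 1, x 2) = some true

/-- The four edges of the limb on `x 0, …, x 4`. -/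
def limbEdgeSet (x : Fin 5 → ℕ) : Set (Sym2 ℕ) :=
  {s(x 0, x 1), s(x 2, x 3), s(x 1, x 4), s(x 1, x 2)}

/-- The limb on `x 0, …, x 4` is a component of `C`: every edge of `C` meeting
a limb vertex is an edge of the limb. -/
def LimbComponent (C : Coloring) (x : Fin 5 → ℕ) : Prop :=
  ∀ e, C e ≠ none → (∃ v ∈ e, v ∈ Set.range x) → e ∈ limbEdgeSet x

/-- The red edges of `C` with at least one end in `S`. -/
def RedAt (C : Coloring) (S : Set ℕ) : Set (Sym2 ℕ) :=
  {e | C e = some true ∧ ∃ v ∈ e, v ∈ S}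

/-- The blue edges of `C` with at least one end in `S`. -/
def BlueAt (C : Coloring) (S : Set ℕ) : Set (Sym2 ℕ) :=
  {e | C e = some false ∧ ∃ v ∈ e, v ∈ S}

def redEdges (C : Coloring) : Set (Sym2 ℕ) := {e | C e = some true}

def blueEdges (C : Coloring) : Set (Sym2 ℕ) := {e | C e = some false}

def allEdges (C : Coloring) : Set (Sym2 ℕ) := {e | C e ≠ none}

/-- The vertices of the coloured graph `C` (ends of coloured edges). -/
def supp (C : Coloring) : Set ℕ := {v | ∃ e, C e ≠ none ∧ v ∈ e}

/-- `a` and `b` are adjacent in `C`. -/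
def Adj (C : Coloring) (a b : ℕ) : Prop := a ≠ b ∧ C s(a, b) ≠ none

/-- `G_0 ∪ Red_H(G_0)` is a component of the coloured graph: every blue edge
meeting the blue path `l` is an edge of `l`, and the other end `y` of any red
edge leaving `l` meets only red edges coming back to `l`. -/
def G0Component (C : Coloring) (l : List ℕ) : Prop :=
  (∀ e, C e = some false → (∃ v ∈ e, v ∈ l) → IsPathEdge l e) ∧
  (∀ x ∈ l, ∀ y : ℕ, C s(x, y) = some true → y ∉ l →
    ∀ e, C e ≠ none → y ∈ e → C e = some true ∧ ∃ v ∈ e, v ∈ l)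

/-- The underlying list of an optional path (`∅` has no vertices). -/
def listOf (o : Option (List ℕ)) : List ℕ := o.getD []

/-- The vertex set of an optional limb. -/
def limbVertsOf : Option (Fin 5 → ℕ) → Set ℕ
  | none => ∅
  | some x => Set.range x

/-- The data of the four (possibly empty) essential subgraphs `(G_0, G_1, G_2, L)`
of a good graph: `G0` is a blue path, `G1` a blue `(1,1)`-path, `G2` an extended
`(2,0)`-path (each given by its vertex sequence), and `L` a limb. -/
structure GoodData where
  G0 : Option (List ℕ)
  G1 : Option (List ℕ)
  G2 : Option (List ℕ)
  L : Option (Fin 5 → ℕ)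

def GoodData.vG0 (D : GoodData) : ℕ := (listOf D.G0).length
def GoodData.vG1 (D : GoodData) : ℕ := (listOf D.G1).length
def GoodData.vG2 (D : GoodData) : ℕ := (listOf D.G2).length
def GoodData.vL (D : GoodData) : ℕ := match D.L with | none => 0 | some _ => 5

/-- The number of essential vertices. -/
def GoodData.ess (D : GoodData) : ℕ := D.vG0 + D.vG1 + D.vG2 + D.vL

/-- The set of essential vertices. -/
def GoodData.verts (D : GoodData) : Set ℕ :=
  {v | v ∈ listOf D.G0} ∪ {v | v ∈ listOf D.G1} ∪ {v | v ∈ listOf D.G2} ∪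
    limbVertsOf D.L

/-- The essential subgraphs are pairwise vertex-disjoint. -/
def GoodData.PartsDisjoint (D : GoodData) : Prop :=
  (∀ x ∈ listOf D.G0, x ∉ listOf D.G1) ∧
  (∀ x ∈ listOf D.G0, x ∉ listOf D.G2) ∧
  (∀ x ∈ listOf D.G0, x ∉ limbVertsOf D.L) ∧
  (∀ x ∈ listOf D.G1, x ∉ listOf D.G2) ∧
  (∀ x ∈ listOf D.G1, x ∉ limbVertsOf D.L) ∧
  (∀ x ∈ listOf D.G2, x ∉ limbVertsOf D.L)

/-- At least three of the four essential subgraphs are empty. -/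
def GoodData.Simple (D : GoodData) : Prop :=
  (D.G0 = none ∧ D.G1 = none ∧ D.G2 = none) ∨
  (D.G0 = none ∧ D.G1 = none ∧ D.L = none) ∨
  (D.G0 = none ∧ D.G2 = none ∧ D.L = none) ∨
  (D.G1 = none ∧ D.G2 = none ∧ D.L = none)

/-- `C` is a good graph with essential subgraphs `D = (G_0, G_1, G_2, L)`:
conditions (A)–(F) of the paper, where `⌈2x/5⌉ = (2x+4)/5` in `ℕ`. -/
def IsGood (C : Coloring) (D : GoodData) : Prop :=
  -- `C` is a (finite) coloured graph
  (allEdges C).Finite ∧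
  (∀ e, C e ≠ none → ¬e.IsDiag) ∧
  -- the essential subgraphs are pairwise vertex-disjoint
  D.PartsDisjoint ∧
  -- (A): `L = ∅` or `L` is a limb and a component of `C`
  (∀ x, D.L = some x → IsLimb C x ∧ LimbComponent C x) ∧
  -- (B): `G0 = ∅` or `G0` is a blue path, `G0 ∪ Red_H(G0)` is a component,
  -- and `|Red_H(G0)| ≤ ⌈2 v(G0)/5⌉ - 1`
  (∀ l, D.G0 = some l → IsBluePath C l ∧ G0Component C l ∧
    (RedAt C {v | v ∈ l}).ncard + 1 ≤ (2 * l.length + 4) / 5) ∧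
  -- (C): `G2 = ∅` or `G2` is an extended (2,0)-path on ≥ 3 vertices
  (∀ l, D.G2 = some l → IsExtPath C l) ∧
  -- (C): `G1 = ∅` or `G1` is a blue (1,1)-path whose 1-ends are not adjacent
  -- to the blue end, the red end or the transition vertex of `G2`
  (∀ l, D.G1 = some l → IsBlue11Path C l ∧
    ∀ l2, D.G2 = some l2 → ∀ a, IsEnd a l → ∀ b : ℕ,
      (l2.head? = some b ∨ l2.getLast? = some b ∨ l2.dropLast.getLast? = some b) →
      ¬Adj C a b) ∧
  -- (C): `Blue_H(G1 ∪ G2) \ E(G1 ∪ G2) = ∅`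
  (∀ e, C e = some false → (∃ v ∈ e, v ∈ listOf D.G1 ∨ v ∈ listOf D.G2) →
    IsPathEdge (listOf D.G1) e ∨ IsPathEdge (listOf D.G2) e) ∧
  -- (C): `|Red_H(G1 ∪ G2)| ≤ ⌈2 v(G1 ∪ G2)/5⌉`
  (RedAt C {v | v ∈ listOf D.G1 ∨ v ∈ listOf D.G2}).ncard ≤
    (2 * (D.vG1 + D.vG2) + 4) / 5 ∧
  -- (D), (E): every edge of `C` has an end among the essential vertices
  (∀ e, C e ≠ none → ∃ v ∈ e, v ∈ D.verts) ∧
  -- (F)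
  (5 ∣ D.vG0 ∨ 5 ∣ D.vG1 + D.vG2)

/-- `C` is a very good graph with essential subgraphs `D`: condition (G). -/
def IsVeryGood (C : Coloring) (D : GoodData) : Prop :=
  IsGood C D ∧ 5 ∣ D.vG0 ∧ 5 ∣ D.vG1 + D.vG2

open Classical in
/-- Delete from `C` the vertices of `S` together with all incident edges. -/
noncomputable def deleteVerts (C : Coloring) (S : Set ℕ) : Coloring :=
  fun e => if ∃ v ∈ e, v ∈ S then none else C e

/-- The union of two (edge-disjoint) coloured graphs. -/
def unionCol (C C' : Coloring) : Coloring :=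
  fun e => match C e with
    | some c => some c
    | none => C' e

end OSR

namespace OSR

/-! ### Forced wins of Builder -/

/-- Builder can end the game `(P_4, P_n)` within `k` further rounds from the position `C`. -/
def Win (n : ℕ) : ℕ → Coloring → Prop
  | 0, C => Ends 4 n C
  | k + 1, C => Ends 4 n C ∨
      ∃ e, C e = none ∧ ¬e.IsDiag ∧ ∀ c, Win n k (Function.update C e (some c))

variable {n : ℕ}

theorem Win.of_ends {C : Coloring} (h : Ends 4 n C) : ∀ k, Win n k C
  | 0 => h
  | _ + 1 => Or.inl h

theorem Win.succ : ∀ {k : ℕ} {C : Coloring}, Win n k C → Win n (k + 1) C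
  | 0, _, h => Or.inl h
  | _ + 1, _, Or.inl h => Or.inl h
  | _ + 1, _, Or.inr ⟨e, he, hd, h⟩ => Or.inr ⟨e, he, hd, fun c => (h c).succ⟩

theorem Win.mono {k l : ℕ} (hkl : k ≤ l) {C : Coloring} (h : Win n k C) : Win n l C := by
  induction hkl with
  | refl => exact h
  | step _ ih => exact ih.succ

/-- Builder may pretend to select `e` even if it is already coloured. -/
theorem Win.select {k : ℕ} {C : Coloring} (e : Sym2 ℕ) (hd : ¬e.IsDiag)
    (h : ∀ (C' : Coloring) (c : Bool), (∀ e' c', C e' = some c' → C' e' = some c') →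
      C' e = some c → Win n k C') : Win n (k + 1) C := by
  cases he : C e with
  | some c => exact (h C c (fun _ _ h => h) he).succ
  | none =>
    refine Or.inr ⟨e, he, hd, fun c => h _ c (fun e' c' he' => ?_) (by simp)⟩
    rw [Function.update_of_ne, he']
    rintro rfl
    simp [he] at he'

theorem play_finite (B : BuilderStrat) (P : PainterStrat) (t : ℕ) :
    {e | play emptyCol B P t e ≠ none}.Finite := by
  induction t with
  | zero => simp [play, emptyCol]
  | succ t ih =>
    refine (ih.insert (B (play emptyCol B P t))).subset fun e he => ?_
    by_cases h : e = B (play emptyCol B P t)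
    · exact Or.inl h
    · exact Or.inr (by simpa [play, Function.update_of_ne h] using he)

theorem exists_unselected {C : Coloring} (hC : {e | C e ≠ none}.Finite) :
    ∃ e, C e = none ∧ ¬e.IsDiag := by
  have hinf : (Set.range fun k : ℕ => s(0, k + 1)).Infinite := by
    refine Set.infinite_range_of_injective fun a b h => ?_
    simpa using h
  obtain ⟨_, ⟨k, rfl⟩, hk⟩ := (hinf.sdiff hC).nonempty
  exact ⟨s(0, k + 1), by simpa using hk, by simp⟩

/-- A forced win from the empty position bounds the online Ramsey number. -/
theorem onlineRamseyPath_le_of_win {k : ℕ} (h : Win n k emptyCol) :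
    onlineRamseyPath 4 n ≤ k := by
  classical
  let rank : Coloring → ℕ := fun C => sInf {k | Win n k C}
  let good : Coloring → Sym2 ℕ → Prop := fun C e => C e = none ∧ ¬e.IsDiag ∧
    ∀ c, Win n (rank C - 1) (Function.update C e (some c))
  let B : BuilderStrat := fun C =>
    if h : ∃ e, good C e then h.choose
    else if h : ∃ e, C e = none ∧ ¬e.IsDiag then h.choose else s(0, 0)
  refine Nat.sInf_le ⟨B, fun P t => ?_, fun P => ?_⟩
  · set C := play emptyCol B P t with hC
    by_cases h₁ : ∃ e, good C e
    · have hB : B C = h₁.choose := dif_pos h₁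
      rw [hB]
      exact ⟨h₁.choose_spec.1, h₁.choose_spec.2.1⟩
    · have h₂ : ∃ e, C e = none ∧ ¬e.IsDiag := exists_unselected (play_finite B P t)
      have hB : B C = h₂.choose := (dif_neg h₁).trans (dif_pos h₂)
      rw [hB]
      exact h₂.choose_spec
  · have key : ∀ k t, Win n k (play emptyCol B P t) →
        ∃ s ≤ t + k, Ends 4 n (play emptyCol B P s) := by
      intro k
      induction k with
      | zero => exact fun t h => ⟨t, le_rfl, h⟩
      | succ k ih =>
        intro t h
        set C := play emptyCol B P t with hC
        have hrank : rank C ≤ k + 1 := Nat.sInf_le h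
        have hmem : Win n (rank C) C := Nat.sInf_mem (s := {k | Win n k C}) ⟨k + 1, h⟩
        by_cases hE : Ends 4 n C
        · exact ⟨t, by omega, hE⟩
        have h₁ : ∃ e, good C e := by
          cases hr : rank C with
          | zero => rw [hr] at hmem; exact absurd hmem hE
          | succ j =>
            rw [hr] at hmem
            obtain ⟨e, he⟩ := hmem.resolve_left hE
            exact ⟨e, by simpa [good, hr] using he⟩
        have hB : B C = h₁.choose := dif_pos h₁
        have hwin : Win n k (play emptyCol B P (t + 1)) := by
          have := (h₁.choose_spec.2.2 (P C h₁.choose)).mono (show rank C - 1 ≤ k by omega)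
          rw [← hB] at this
          exact this
        obtain ⟨s, hs, hs'⟩ := ih (t + 1) hwin
        exact ⟨s, by omega, hs'⟩
    simpa using key k 0 h

theorem hasPath_of_list {C : Coloring} {c : Bool} {l : List ℕ} (hl : l.Nodup)
    (hc : l.IsChain fun a b => C s(a, b) = some c) {k : ℕ} (hk : k ≤ l.length) :
    HasPath C c k := by
  refine ⟨fun i => l[(i : ℕ)], fun i j h => ?_, fun i j hij => ?_⟩
  · exact Fin.ext ((List.Nodup.getElem_inj_iff hl).1 h)
  · have := List.isChain_iff_getElem.1 hc i (by omega)
    simpa [hij] using this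

/-! ### Positions and certificates -/

/-- The kinds of positions through which Builder's strategy runs. In all of them there is a
long blue path with ends labelled `0` and `1`. -/
inductive Fam
  /-- Nothing is known about the ends of the path. -/
  | A
  /-- The end `1` is incident with a red edge. -/
  | B
  /-- The end `1` is joined by a red edge to the vertex `2` outside the path. -/
  | C
  /-- The end `1` is an end of a red path `1, 2, 3`, where `2` is outside the path. -/
  | D
  deriving DecidableEq

/-- The red edges between labelled vertices in a position of the given family. -/
def Fam.edges : Fam → List (ℕ × ℕ × Bool)
  | .A => []
  | .B => [(1, 3, true)]
  | .C => [(1, 2, true)]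
  | .D => [(1, 2, true), (2, 3, true)]

def Fam.const : Fam → ℕ
  | .A => 6
  | .B => 4
  | .C => 2
  | .D => 2

/-- The number of rounds that suffices when the path has to grow by `r` vertices. -/
def rounds (f : Fam) (r : ℕ) : ℕ :=
  r + match f, r with
    | _, 0 => 0
    | .A, 1 => 2
    | .B, 1 => 1
    | .B, 2 => 2
    | .C, 1 => 1
    | f, r => (2 * r + f.const) / 5

/-- The coloured edges `E` between labels are present in `C` under the labelling `φ`, together
with a blue path `P` on `m` vertices from the label `0` to the label `1`. Among the other labels
only `3` may lie on `P`. -/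
structure Pos (C : Coloring) (φ : ℕ → ℕ) (P : List ℕ) (m : ℕ) (E : List (ℕ × ℕ × Bool)) :
    Prop where
  inj : Function.Injective φ
  nodup : P.Nodup
  chain : P.IsChain fun a b => C s(a, b) = some false
  head : P.head? = some (φ 0)
  last : P.getLast? = some (φ 1)
  mem : ∀ k, φ k ∈ P → k = 0 ∨ k = 1 ∨ k = 3
  length : P.length = m
  edges : ∀ e ∈ E, C s(φ e.1, φ e.2.1) = some e.2.2

/-- A certificate for a strategy of Builder. -/
inductive Tree
  /-- Stop: the blue path extended by the two given label sequences is long enough. -/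
  | fin (L₁ L₂ : List ℕ)
  /-- Continue from a position of the family `f`, whose blue path is the old one extended by
  the two label sequences (and reversed if `flip`), and whose labels `2`, `3` are `p`, `q`. -/
  | leaf (f : Fam) (flip : Bool) (L₁ L₂ : List ℕ) (p q : ℕ)
  /-- Select the edge `ab`; continue according to its colour (red, blue). -/
  | ask (a b : ℕ) (red blue : Tree)
  /-- Select the edge `ab`, where red would complete the red path `x y z w`. -/
  | force (a b x y z w : ℕ) (blue : Tree)

def hasEdge (E : List (ℕ × ℕ × Bool)) (c : Bool) (a b : ℕ) : Bool :=
  E.any fun e => e.2.2 == c && ((e.1 == a && e.2.1 == b) || (e.1 == b && e.2.1 == a))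

/-- The blue path can be extended by the label sequences `L₁` and `L₂`. -/
def Extends (E : List (ℕ × ℕ × Bool)) (L₁ L₂ : List ℕ) : Prop :=
  (L₁ ++ L₂).Nodup ∧ (∀ x ∈ L₁ ++ L₂, x ≠ 0 ∧ x ≠ 1 ∧ x ≠ 3 ∧ x < 30) ∧
  (L₁ ++ [0]).IsChain (fun a b => hasEdge E false a b) ∧
  (1 :: L₂).IsChain (fun a b => hasEdge E false a b)

instance (E : List (ℕ × ℕ × Bool)) (L₁ L₂ : List ℕ) : Decidable (Extends E L₁ L₂) := by
  unfold Extends; infer_instance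

/-- The old labels of the vertices labelled `0, 1, 2, …` in the new position. -/
def oldLabel (x y p q : ℕ) : ℕ → ℕ
  | 0 => x
  | 1 => y
  | 2 => p
  | 3 => q
  | k => k + 30

def HasOldLabels (f : Fam) (E : List (ℕ × ℕ × Bool)) (L : List ℕ) (x y p q : ℕ) : Prop :=
  [x, y, p, q].Nodup ∧ (∀ z ∈ [x, y, p, q], z < 30) ∧ p ≠ 0 ∧ p ≠ 1 ∧ p ≠ 3 ∧ p ∉ L ∧
  ∀ e ∈ f.edges, hasEdge E e.2.2 (oldLabel x y p q e.1) (oldLabel x y p q e.2.1)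

instance (f : Fam) (E : List (ℕ × ℕ × Bool)) (L : List ℕ) (x y p q : ℕ) :
    Decidable (HasOldLabels f E L x y p q) := by
  unfold HasOldLabels; infer_instance

/-- `T` is a valid certificate from a position with edges `E` in which `t` rounds have been
played, where `ok o g t` tells whether stopping (`o = none`), or passing to a family, is
acceptable after the path has gained `g` vertices in `t` rounds. -/
def check (ok : Option Fam → ℕ → ℕ → Bool) : List (ℕ × ℕ × Bool) → ℕ → Tree → Bool
  | E, t, .fin L₁ L₂ => decide (Extends E L₁ L₂) && ok none (L₁.length + L₂.length) t
  | E, t, .leaf f flip L₁ L₂ p q =>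
    decide (Extends E L₁ L₂) && ok (some f) (L₁.length + L₂.length) t &&
    bif flip then decide (HasOldLabels f E (L₁ ++ L₂) (L₂.getLastD 1) (L₁.headD 0) p q)
    else decide (HasOldLabels f E (L₁ ++ L₂) (L₁.headD 0) (L₂.getLastD 1) p q)
  | E, t, .ask a b red blue =>
    a != b && check ok ((a, b, true) :: E) (t + 1) red &&
      check ok ((a, b, false) :: E) (t + 1) blue
  | E, t, .force a b x y z w blue =>
    a != b && decide [x, y, z, w].Nodup &&
      decide ([x, y, z, w].IsChain fun u v => hasEdge ((a, b, true) :: E) true u v) &&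
      check ok ((a, b, false) :: E) (t + 1) blue

variable {C : Coloring} {φ : ℕ → ℕ} {P : List ℕ} {m : ℕ} {E : List (ℕ × ℕ × Bool)}

theorem Pos.of_hasEdge (h : Pos C φ P m E) {c : Bool} {a b : ℕ} (hab : hasEdge E c a b) :
    C s(φ a, φ b) = some c := by
  obtain ⟨⟨u, v, d⟩, he, hc⟩ := List.any_eq_true.1 hab
  have := h.edges _ he
  simp only [Bool.and_eq_true, Bool.or_eq_true, beq_iff_eq] at hc
  obtain ⟨rfl, ⟨rfl, rfl⟩ | ⟨rfl, rfl⟩⟩ := hc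
  · exact this
  · rwa [Sym2.eq_swap]

theorem Pos.select (h : Pos C φ P m E) {C' : Coloring}
    (hC : ∀ e c, C e = some c → C' e = some c) {a b : ℕ} {c : Bool}
    (hab : C' s(φ a, φ b) = some c) : Pos C' φ P m ((a, b, c) :: E) where
  inj := h.inj
  nodup := h.nodup
  chain := h.chain.imp fun _ _ => hC _ _
  head := h.head
  last := h.last
  mem := h.mem
  length := h.length
  edges := by
    rintro e (_ | ⟨_, he⟩)
    · exact hab
    · exact hC _ _ (h.edges e he)

theorem Pos.isChain_map (h : Pos C φ P m E) {c : Bool} {L : List ℕ}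
    (hL : L.IsChain fun a b => hasEdge E c a b) :
    (L.map φ).IsChain fun a b => C s(a, b) = some c :=
  (List.isChain_map φ).2 (hL.imp fun _ _ => h.of_hasEdge)

theorem Pos.extend (h : Pos C φ P m E) {L₁ L₂ : List ℕ} (hL : Extends E L₁ L₂) :
    (L₁.map φ ++ P ++ L₂.map φ).Nodup ∧
      (L₁.map φ ++ P ++ L₂.map φ).IsChain fun a b => C s(a, b) = some false := by
  obtain ⟨hnd, hlt, hc₁, hc₂⟩ := hL
  have hP : ∀ x ∈ L₁ ++ L₂, φ x ∉ P := fun x hx hx' => by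
    have := h.mem x hx'
    have := hlt x hx
    omega
  have hc₁' := h.isChain_map hc₁
  have hc₂' := h.isChain_map hc₂
  constructor
  · have h₁ := hnd.map h.inj
    simp only [List.map_append, List.nodup_append] at h₁
    simp only [List.nodup_append, List.mem_append, List.mem_map]
    refine ⟨⟨h₁.1, h.nodup, ?_⟩, h₁.2.1, ?_⟩
    · rintro _ ⟨x, hx, rfl⟩ b hb rfl
      exact hP x (List.mem_append_left _ hx) hb
    · rintro a (ha | ha) _ ⟨y, hy, rfl⟩ rfl
      · exact h₁.2.2 _ (List.mem_map.2 ha) _ (List.mem_map_of_mem hy) rfl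
      · exact hP y (List.mem_append_right _ hy) ha
  · rw [List.map_append, List.isChain_append] at hc₁'
    rw [List.map_cons, List.isChain_cons] at hc₂'
    rw [List.isChain_append, List.isChain_append]
    refine ⟨⟨hc₁'.1, h.chain, fun x hx y hy => hc₁'.2.2 x hx y ?_⟩, hc₂'.2, fun x hx y hy => ?_⟩
    · simpa [h.head] using hy
    · have hx' : x = φ 1 := by
        rw [List.getLast?_append, h.last] at hx
        simpa using hx.symm
      subst hx'
      exact hc₂'.1 y hy

theorem oldLabel_injective {x y p q : ℕ} (hnd : [x, y, p, q].Nodup)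
    (hlt : ∀ z ∈ [x, y, p, q], z < 30) : Function.Injective (oldLabel x y p q) := by
  simp only [List.mem_cons, List.not_mem_nil, or_false, forall_eq_or_imp, forall_eq] at hlt
  simp only [List.nodup_cons, List.mem_cons, List.not_mem_nil, or_false, not_or] at hnd
  rintro (_ | _ | _ | _ | i) (_ | _ | _ | _ | j) hij <;> simp only [oldLabel] at hij <;> omega

theorem Pos.oldLabel (h : Pos C φ P m E) {L₁ L₂ : List ℕ} (hL : Extends E L₁ L₂) {f : Fam}
    {x y p q : ℕ} (hR : HasOldLabels f E (L₁ ++ L₂) x y p q) {Q : List ℕ}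
    (hQ : Q.Perm (L₁.map φ ++ P ++ L₂.map φ))
    (hc : Q.IsChain fun a b => C s(a, b) = some false)
    (hx : Q.head? = some (φ x)) (hy : Q.getLast? = some (φ y)) :
    Pos C (φ ∘ oldLabel x y p q) Q (m + (L₁.length + L₂.length)) f.edges where
  inj := h.inj.comp (oldLabel_injective hR.1 hR.2.1)
  nodup := hQ.nodup_iff.2 (h.extend hL).1
  chain := hc
  head := hx
  last := hy
  mem := by
    obtain ⟨-, hlt, h0, h1, h3, hp, -⟩ := hR
    intro k hk
    have hk' : OSR.oldLabel x y p q k ∈ L₁ ++ L₂ ∨ φ (OSR.oldLabel x y p q k) ∈ P := by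
      have := hQ.subset hk
      simp only [Function.comp, List.mem_append, List.mem_map_of_injective h.inj] at this ⊢
      tauto
    have hk'' : OSR.oldLabel x y p q k = p ∨ 30 ≤ OSR.oldLabel x y p q k → False := by
      rintro (he | he)
      · rw [he] at hk'
        exact hk'.elim hp fun hP => by have := h.mem p hP; omega
      · rcases hk' with hk' | hk'
        · have := hL.2.1 _ hk'
          omega
        · have := h.mem _ hk'
          omega
    rcases k with _ | _ | _ | _ | k
    · simp
    · simp
    · exact (hk'' (Or.inl rfl)).elim
    · simp
    · exact (hk'' (Or.inr (by simp [OSR.oldLabel]))).elim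
  length := by
    rw [hQ.length_eq]
    simp only [List.length_append, List.length_map, h.length]
    omega
  edges := fun e he => h.of_hasEdge (hR.2.2.2.2.2.2 e he)

theorem check_le {ok : Option Fam → ℕ → ℕ → Bool} {K : ℕ} (hok : ∀ o g t, ok o g t → t ≤ K) :
    ∀ (T : Tree) (E : List (ℕ × ℕ × Bool)) (t : ℕ), check ok E t T → t ≤ K
  | .fin L₁ L₂, E, t, h => by
    simp only [check, Bool.and_eq_true] at h
    exact hok _ _ _ h.2
  | .leaf f flip L₁ L₂ p q, E, t, h => by
    simp only [check, Bool.and_eq_true] at h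
    exact hok _ _ _ h.1.2
  | .ask a b red blue, E, t, h => by
    simp only [check, Bool.and_eq_true] at h
    exact (Nat.le_succ t).trans (check_le hok blue _ _ h.2)
  | .force a b x y z w blue, E, t, h => by
    simp only [check, Bool.and_eq_true] at h
    exact (Nat.le_succ t).trans (check_le hok blue _ _ h.2)

theorem win_of_check {ok : Option Fam → ℕ → ℕ → Bool} {K : ℕ}
    (hok : ∀ o g t, ok o g t → t ≤ K) (hfin : ∀ g t, ok none g t → n ≤ m + g)
    (hfam : ∀ f g t, ok (some f) g t → ∀ C φ P, Pos C φ P (m + g) f.edges → Win n (K - t) C) :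
    ∀ (T : Tree) (E : List (ℕ × ℕ × Bool)) (t : ℕ), check ok E t T →
      ∀ C, Pos C φ P m E → Win n (K - t) C
  | .fin L₁ L₂, E, t, h, C, hC => by
    simp only [check, Bool.and_eq_true, decide_eq_true_eq] at h
    obtain ⟨hnd, hc⟩ := hC.extend h.1
    refine Win.of_ends (Or.inr (hasPath_of_list hnd hc ?_)) _
    have := hfin _ _ h.2
    simp only [List.length_append, List.length_map, hC.length]
    omega
  | .leaf f flip L₁ L₂ p q, E, t, h, C, hC => by
    simp only [check, Bool.and_eq_true, decide_eq_true_eq] at h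
    obtain ⟨⟨hL, hg⟩, hR⟩ := h
    obtain ⟨hnd, hc⟩ := hC.extend hL
    have hx : (L₁.map φ ++ P ++ L₂.map φ).head? = some (φ (L₁.headD 0)) := by
      cases L₁ <;> simp [hC.head]
    have hy : (L₁.map φ ++ P ++ L₂.map φ).getLast? = some (φ (L₂.getLastD 1)) := by
      rw [List.getLast?_append, List.getLast?_append, hC.last, List.getLast?_map]
      cases hl : L₂.getLast? <;> simp [List.getLastD_eq_getLast?, hl]
    cases flip with
    | true =>
      refine hfam f _ t hg C _ _ (hC.oldLabel hL (of_decide_eq_true hR) (List.reverse_perm _) ?_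
        (by rw [List.head?_reverse, hy]) (by rw [List.getLast?_reverse, hx]))
      rw [List.isChain_reverse]
      refine hc.imp fun a b hab => ?_
      rwa [Sym2.eq_swap]
    | false =>
      exact hfam f _ t hg C _ _ (hC.oldLabel hL (of_decide_eq_true hR) (List.Perm.refl _) hc hx hy)
  | .ask a b red blue, E, t, h, C, hC => by
    simp only [check, Bool.and_eq_true, bne_iff_ne] at h
    obtain ⟨⟨hab, hred⟩, hblue⟩ := h
    have ht := check_le hok _ _ _ hblue
    rw [show K - t = K - (t + 1) + 1 by omega]
    refine Win.select s(φ a, φ b) (by simpa using hC.inj.ne hab) fun C' c hCC' hc => ?_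
    cases c with
    | true => exact win_of_check hok hfin hfam red _ _ hred C' (hC.select hCC' hc)
    | false => exact win_of_check hok hfin hfam blue _ _ hblue C' (hC.select hCC' hc)
  | .force a b x y z w blue, E, t, h, C, hC => by
    simp only [check, Bool.and_eq_true, bne_iff_ne, decide_eq_true_eq] at h
    obtain ⟨⟨⟨hab, hnd⟩, hch⟩, hblue⟩ := h
    have ht := check_le hok _ _ _ hblue
    rw [show K - t = K - (t + 1) + 1 by omega]
    refine Win.select s(φ a, φ b) (by simpa using hC.inj.ne hab) fun C' c hCC' hc => ?_
    cases c with
    | true =>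
      exact Win.of_ends (Or.inl (hasPath_of_list (hnd.map hC.inj)
        ((hC.select hCC' hc).isChain_map hch) (by simp))) _
    | false => exact win_of_check hok hfin hfam blue _ _ hblue C' (hC.select hCC' hc)

/-! ### The strategy -/

/-- Builder's strategy for a position of family `f` with `r` vertices still missing; the
same tree serves all `r ≥ 9`. -/
def strategy : Fam → ℕ → Tree
  | .A, 1 =>
    .ask 0 4 (.leaf .B true [] [] 20 4) (.fin [4] [])
  | .A, 2 =>
    .ask 0 4 (.leaf .C true [] [] 4 21) (.leaf .A false [4] [] 20 21)
  | .A, 3 =>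
    .ask 0 4 (.leaf .C true [] [] 4 21) (.leaf .A false [4] [] 20 21)
  | .A, 4 =>
    .ask 4 5 (.ask 4 6 (.force 0 5 0 5 4 6 (.force 6 1 1 6 4 5 (.force 6 7 5 4 6 7 (.leaf .D
      true [5] [6, 7] 4 6)))) (.ask 0 7 (.force 0 5 4 5 0 7 (.force 5 7 0 7 5 4 (.force 4 7 0 7
      4 5 (.fin [6, 4, 7, 5] [])))) (.ask 1 6 (.force 5 1 4 5 1 6 (.force 6 5 1 6 5 4 (.fin [7]
      [5, 6, 4]))) (.leaf .B false [7] [6, 4] 20 5)))) (.ask 4 6 (.ask 0 7 (.force 0 6 4 6 0 7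
      (.force 6 7 0 7 6 4 (.force 4 7 0 7 4 6 (.fin [5, 4, 7, 6] [])))) (.ask 1 5 (.force 6 1 4
      6 1 5 (.force 5 6 1 5 6 4 (.fin [7] [6, 5, 4]))) (.leaf .B false [7] [5, 4] 20 6))) (.ask
      0 5 (.ask 0 6 (.force 5 1 1 5 0 6 (.force 6 7 5 0 6 7 (.fin [] [5, 4, 6, 7]))) (.leaf .B
      true [5, 4, 6] [] 20 0)) (.leaf .A false [6, 4, 5] [] 20 21)))
  | .A, 5 =>
    .ask 0 4 (.leaf .B true [] [] 20 4) (.leaf .A false [4] [] 20 21)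
  | .A, 6 =>
    .ask 0 4 (.leaf .C true [] [] 4 21) (.leaf .A false [4] [] 20 21)
  | .A, 7 =>
    .ask 0 4 (.leaf .B true [] [] 20 4) (.leaf .A false [4] [] 20 21)
  | .A, 8 =>
    .ask 0 4 (.leaf .C true [] [] 4 21) (.leaf .A false [4] [] 20 21)
  | .A, _ =>
    .ask 4 5 (.ask 4 6 (.force 0 5 0 5 4 6 (.force 6 1 1 6 4 5 (.force 6 7 5 4 6 7 (.leaf .D
      true [5] [6, 7] 4 6)))) (.ask 0 4 (.force 5 6 0 4 5 6 (.force 5 1 0 4 5 1 (.force 0 7 5 4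
      0 7 (.leaf .B false [7] [5, 6, 4] 20 5)))) (.ask 1 7 (.force 5 1 4 5 1 7 (.force 5 7 1 7 5
      4 (.leaf .B false [6, 4] [5, 7] 20 1))) (.leaf .A false [6, 4] [7] 20 21)))) (.ask 4 6
      (.ask 0 4 (.force 6 5 0 4 6 5 (.force 6 1 0 4 6 1 (.force 0 7 6 4 0 7 (.leaf .B false [7]
      [6, 5, 4] 20 6)))) (.ask 1 7 (.force 6 1 4 6 1 7 (.force 6 7 1 7 6 4 (.leaf .B false [5,
      4] [6, 7] 20 1))) (.leaf .A false [5, 4] [7] 20 21))) (.ask 0 5 (.ask 0 6 (.force 5 1 1 5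
      0 6 (.force 6 7 5 0 6 7 (.leaf .B true [] [5, 4, 6, 7] 20 6))) (.leaf .A false [5, 4, 6]
      [] 20 21)) (.leaf .A false [6, 4, 5] [] 20 21)))
  | .B, 1 =>
    .ask 0 4 (.force 1 4 0 4 1 3 (.fin [] [4])) (.fin [4] [])
  | .B, 2 =>
    .ask 0 4 (.leaf .C true [] [] 4 21) (.leaf .A false [4] [] 20 21)
  | .B, 3 =>
    .ask 0 4 (.leaf .C true [] [] 4 21) (.leaf .A false [4] [] 20 21)
  | .B, 4 =>
    .ask 4 5 (.force 4 1 3 1 4 5 (.leaf .C false [] [4] 5 21)) (.ask 4 6 (.force 6 1 3 1 6 4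
      (.ask 6 5 (.force 0 5 0 5 6 4 (.force 4 7 5 6 4 7 (.fin [7, 4, 5] [6]))) (.leaf .B false
      [] [6, 5, 4] 20 6))) (.ask 5 0 (.force 5 1 0 5 1 3 (.leaf .B true [] [5, 4, 6] 20 5))
      (.leaf .A false [6, 4, 5] [] 20 21)))
  | .B, 5 =>
    .ask 4 5 (.ask 4 6 (.force 4 1 3 1 4 5 (.force 5 0 0 5 4 6 (.force 5 7 6 4 5 7 (.force 7 6 5
      4 6 7 (.force 6 8 5 4 6 8 (.fin [8, 6, 7, 5] [4])))))) (.ask 7 8 (.force 7 4 5 4 7 8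
      (.force 5 8 4 5 8 7 (.force 5 7 4 5 7 8 (.force 8 1 3 1 8 7 (.fin [] [8, 5, 7, 4, 6])))))
      (.force 4 1 3 1 4 5 (.ask 7 6 (.force 7 5 4 5 7 6 (.force 6 5 4 5 6 7 (.fin [] [4, 6, 5,
      7, 8]))) (.ask 5 8 (.leaf .D false [] [4, 6, 7, 8] 5 4) (.fin [] [4, 6, 7, 8, 5]))))))
      (.ask 4 6 (.ask 7 8 (.force 7 4 6 4 7 8 (.force 6 8 4 6 8 7 (.force 6 7 4 6 7 8 (.force 8
      1 3 1 8 7 (.fin [] [8, 6, 7, 4, 5]))))) (.force 4 1 3 1 4 6 (.ask 7 5 (.force 7 6 4 6 7 5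
      (.force 5 6 4 6 5 7 (.fin [] [4, 5, 6, 7, 8]))) (.ask 6 8 (.leaf .D false [] [4, 5, 7, 8]
      6 4) (.fin [] [4, 5, 7, 8, 6]))))) (.ask 5 7 (.force 7 1 3 1 7 5 (.ask 0 5 (.force 0 6 6 0
      5 7 (.force 7 8 0 5 7 8 (.fin [5, 4, 6] [7, 8]))) (.leaf .B false [6, 4, 5] [7] 20 5)))
      (.ask 6 0 (.force 1 6 0 6 1 3 (.leaf .B true [] [6, 4, 5, 7] 20 6)) (.leaf .A false [7, 5,
      4, 6] [] 20 21))))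
  | .B, 6 =>
    .ask 0 4 (.leaf .C true [] [] 4 21) (.leaf .A false [4] [] 20 21)
  | .B, 7 =>
    .ask 1 4 (.force 4 0 0 4 1 3 (.force 4 5 3 1 4 5 (.leaf .B false [5, 4] [] 20 4))) (.leaf .A
      false [] [4] 20 21)
  | .B, 8 =>
    .ask 0 4 (.leaf .C true [] [] 4 21) (.leaf .A false [4] [] 20 21)
  | .B, _ =>
    .ask 4 5 (.ask 4 6 (.force 4 1 3 1 4 5 (.force 5 0 0 5 4 6 (.force 5 7 6 4 5 7 (.force 7 6 5
      4 6 7 (.force 6 8 5 4 6 8 (.leaf .B false [8, 6, 7, 5] [4] 20 6)))))) (.ask 5 7 (.force 4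
      0 0 4 5 7 (.force 1 5 3 1 5 4 (.force 6 7 4 5 7 6 (.force 7 8 4 5 7 8 (.leaf .B false [8,
      7, 6, 4] [5] 20 7))))) (.ask 1 8 (.force 6 8 3 1 8 6 (.force 8 0 0 8 1 3 (.force 1 5 3 1 5
      4 (.leaf .B true [4, 6, 8] [5, 7] 20 5)))) (.ask 0 4 (.force 8 5 0 4 5 8 (.force 0 6 5 4 0
      6 (.leaf .B true [4, 6] [8, 5, 7] 20 5))) (.ask 5 8 (.force 8 7 4 5 8 7 (.leaf .B false
      [6, 4] [8, 7, 5] 20 8)) (.leaf .A false [6, 4] [8, 5, 7] 20 21)))))) (.ask 1 6 (.force 4 6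
      3 1 6 4 (.force 6 0 0 6 1 3 (.leaf .B false [5, 4, 6] [] 20 6))) (.ask 0 7 (.ask 4 0
      (.force 6 4 6 4 0 7 (.force 5 7 4 0 7 5 (.force 7 8 4 0 7 8 (.leaf .B true [] [6, 4, 5, 7,
      8] 20 7)))) (.ask 5 8 (.force 8 7 0 7 8 5 (.force 5 7 0 7 5 8 (.leaf .B true [8, 7, 5, 4]
      [6] 20 5))) (.leaf .A false [8, 5, 4] [6] 20 21))) (.ask 4 6 (.ask 4 7 (.force 7 5 5 7 4 6
      (.force 6 8 7 4 6 8 (.leaf .B true [4, 5, 7] [6, 8] 20 7))) (.leaf .A false [5, 4, 7] [6]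
      20 21)) (.leaf .A false [7] [6, 4, 5] 20 21))))
  | .C, 1 =>
    .ask 1 4 (.force 0 2 0 2 1 4 (.fin [2] [])) (.fin [] [4])
  | .C, 2 =>
    .ask 0 4 (.force 1 4 0 4 1 2 (.force 0 2 1 2 0 4 (.fin [2] [4]))) (.leaf .B false [4] [] 20
      2)
  | .C, 3 =>
    .ask 2 4 (.force 4 0 0 4 2 1 (.force 4 5 1 2 4 5 (.leaf .D false [5, 4] [] 2 4))) (.ask 4 1
      (.force 4 0 0 4 1 2 (.force 2 5 4 1 2 5 (.fin [5, 2, 4] []))) (.leaf .B false [] [4, 2] 20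
      1))
  | .C, 4 =>
    .ask 0 2 (.force 1 4 0 2 1 4 (.leaf .D true [] [4] 2 1)) (.leaf .A false [2] [] 20 21)
  | .C, 5 =>
    .ask 1 4 (.force 0 2 0 2 1 4 (.force 2 5 4 1 2 5 (.leaf .C false [5, 2] [] 4 21))) (.leaf .A
      false [] [4] 20 21)
  | .C, 6 =>
    .ask 4 5 (.force 4 2 1 2 4 5 (.ask 5 6 (.force 4 7 6 5 4 7 (.force 1 5 2 1 5 4 (.force 6 0 0
      6 5 4 (.force 6 8 4 5 6 8 (.force 2 5 1 2 5 4 (.fin [8, 6] [5, 2, 4, 7])))))) (.ask 7 8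
      (.force 5 7 4 5 7 8 (.force 2 8 1 2 8 7 (.force 1 8 2 1 8 7 (.force 4 7 5 4 7 8 (.fin []
      [8, 2, 4, 7, 5, 6]))))) (.force 5 2 1 2 5 4 (.ask 7 0 (.force 7 1 0 7 1 2 (.force 0 4 5 4
      0 7 (.fin [6, 5, 2, 4] [7, 8]))) (.force 1 4 2 1 4 5 (.fin [8, 7] [4, 2, 5, 6])))))))
      (.ask 4 6 (.force 1 6 2 1 6 4 (.ask 7 8 (.force 6 7 4 6 7 8 (.force 4 8 6 4 8 7 (.force 7
      2 1 2 7 8 (.force 2 8 1 2 8 7 (.fin [] [6, 7, 2, 8, 4, 5]))))) (.force 6 2 1 2 6 4 (.ask 5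
      7 (.force 4 7 5 7 4 6 (.force 2 5 1 2 5 7 (.fin [] [6, 2, 5, 4, 7, 8]))) (.force 2 4 1 2 4
      6 (.fin [] [6, 2, 4, 5, 7, 8])))))) (.ask 1 5 (.force 0 5 0 5 1 2 (.leaf .C false [6, 4,
      5] [] 2 21)) (.leaf .A false [] [5, 4, 6] 20 21)))
  | .C, 7 =>
    .ask 0 2 (.force 1 4 0 2 1 4 (.leaf .D true [] [4] 2 1)) (.leaf .A false [2] [] 20 21)
  | .C, 8 =>
    .ask 1 4 (.force 0 2 0 2 1 4 (.force 2 5 4 1 2 5 (.leaf .C false [5, 2] [] 4 21))) (.ask 0 5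
      (.force 2 0 1 2 0 5 (.force 2 5 0 5 2 1 (.leaf .B true [5, 2] [4] 20 0))) (.leaf .A false
      [5] [4] 20 21))
  | .C, _ =>
    .ask 4 5 (.ask 4 6 (.force 1 4 2 1 4 5 (.force 5 0 0 5 4 6 (.force 5 7 6 4 5 7 (.force 4 2 1
      2 4 5 (.force 6 7 5 4 6 7 (.force 6 8 5 4 6 8 (.leaf .B false [8, 6, 7, 5] [4, 2] 20
      1))))))) (.ask 2 7 (.force 7 0 0 7 2 1 (.force 7 6 1 2 7 6 (.force 2 4 1 2 4 5 (.force 5 2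
      1 2 5 4 (.force 1 8 7 2 1 8 (.leaf .B true [5, 2, 4, 6, 7] [8] 20 4)))))) (.ask 7 4
      (.force 0 5 0 5 4 7 (.force 1 4 2 1 4 5 (.force 6 7 5 4 7 6 (.force 5 8 7 4 5 8 (.leaf .B
      false [8, 5] [4, 6, 7, 2] 20 1))))) (.force 2 5 1 2 5 4 (.force 5 1 2 1 5 4 (.leaf .A
      false [] [5, 2, 7, 4, 6] 20 21)))))) (.ask 4 1 (.force 4 0 0 4 1 2 (.force 2 5 4 1 2 5
      (.force 2 6 4 1 2 6 (.leaf .B false [6, 2, 5, 4] [] 20 4)))) (.leaf .A false [] [4, 5] 20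
      21))
  | .D, 1 =>
    .force 1 4 3 2 1 4 (.fin [] [4])
  | .D, 2 =>
    .force 1 4 3 2 1 4 (.ask 0 2 (.force 0 5 1 2 0 5 (.fin [5] [4])) (.fin [2] [4]))
  | .D, 3 =>
    .ask 0 4 (.force 2 0 1 2 0 4 (.force 2 4 0 4 2 1 (.force 1 5 3 2 1 5 (.fin [4, 2] [5]))))
      (.leaf .D false [4] [] 2 3)
  | .D, 4 =>
    .force 1 4 3 2 1 4 (.leaf .A false [] [4] 20 21)
  | .D, 5 =>
    .force 1 4 3 2 1 4 (.leaf .A false [] [4] 20 21)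
  | .D, 6 =>
    .ask 4 5 (.force 4 2 1 2 4 5 (.ask 4 6 (.force 1 4 2 1 4 5 (.force 0 5 0 5 4 6 (.force 2 6 1
      2 6 4 (.force 5 7 6 4 5 7 (.force 6 8 5 4 6 8 (.fin [7, 5] [4, 2, 6, 8])))))) (.ask 0 7
      (.force 7 2 0 7 2 1 (.force 7 5 0 7 5 4 (.force 5 0 4 5 0 7 (.force 1 8 3 2 1 8 (.fin [6,
      4, 2, 7, 5] [8]))))) (.force 6 1 3 2 1 6 (.force 2 5 1 2 5 4 (.leaf .B false [7] [6, 4, 2,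
      5] 20 4)))))) (.force 4 1 3 2 1 4 (.leaf .A false [] [4, 5] 20 21))
  | .D, 7 =>
    .force 1 4 3 2 1 4 (.leaf .A false [] [4] 20 21)
  | .D, 8 =>
    .ask 2 4 (.force 4 0 0 4 2 1 (.force 4 5 1 2 4 5 (.leaf .C false [5, 4] [] 2 21))) (.force 4
      1 3 2 1 4 (.leaf .A false [] [4, 2] 20 21))
  | .D, _ =>
    .ask 4 5 (.force 4 2 1 2 4 5 (.force 2 5 1 2 5 4 (.ask 4 6 (.force 0 6 0 6 4 5 (.force 5 7 6
      4 5 7 (.force 6 7 5 4 6 7 (.force 1 8 3 2 1 8 (.leaf .B true [4, 2, 5, 7, 6] [8] 20 6)))))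
      (.force 1 6 3 2 1 6 (.leaf .B false [] [6, 4, 2, 5] 20 4))))) (.force 4 1 3 2 1 4 (.leaf
      .A false [] [4, 5] 20 21))

/-- When to stop, or to pass to another family, if `r` vertices are missing. -/
def okSmall (f : Fam) (r : ℕ) : Option Fam → ℕ → ℕ → Bool
  | none, g, t => decide (r ≤ g ∧ t ≤ rounds f r)
  | some f', g, t => decide (g ≤ r ∧ 0 < t ∧ t + rounds f' (r - g) ≤ rounds f r)

/-- When to pass to another family if at least `9` vertices are missing. -/
def okLarge (f : Fam) : Option Fam → ℕ → ℕ → Bool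
  | none, _, _ => false
  | some f', g, t => decide (g ≤ 6 ∧ 0 < t ∧ 5 * t + f'.const ≤ 7 * g + f.const)

theorem check_small (f : Fam) (r : ℕ) (h0 : 0 < r) (hr : r < 9) :
    check (okSmall f r) f.edges 0 (strategy f r) = true := by
  interval_cases r <;> cases f <;> decide +kernel

theorem check_large (f : Fam) (r : ℕ) (hr : 9 ≤ r) :
    check (okLarge f) f.edges 0 (strategy f r) = true := by
  obtain ⟨r, rfl⟩ := Nat.exists_eq_add_of_le' hr
  cases f <;> exact Eq.refl true

theorem rounds_eq (f : Fam) {r : ℕ} (hr : 3 ≤ r) : rounds f r = r + (2 * r + f.const) / 5 := by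
  obtain ⟨r, rfl⟩ := Nat.exists_eq_add_of_le' hr
  cases f <;> rfl

theorem okSmall_of_okLarge {f : Fam} {r : ℕ} (hr : 9 ≤ r) (o : Option Fam) (g t : ℕ)
    (h : okLarge f o g t) : okSmall f r o g t := by
  cases o with
  | none => simp [okLarge] at h
  | some f' =>
    simp only [okLarge, okSmall, decide_eq_true_eq] at h ⊢
    rw [rounds_eq f' (by omega), rounds_eq f (by omega)]
    omega

theorem check_mono {ok ok' : Option Fam → ℕ → ℕ → Bool} (hok : ∀ o g t, ok o g t → ok' o g t) :
    ∀ (T : Tree) (E : List (ℕ × ℕ × Bool)) (t : ℕ), check ok E t T → check ok' E t T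
  | .fin L₁ L₂, E, t, h => by
    simp only [check, Bool.and_eq_true] at h ⊢
    exact ⟨h.1, hok _ _ _ h.2⟩
  | .leaf f flip L₁ L₂ p q, E, t, h => by
    simp only [check, Bool.and_eq_true] at h ⊢
    exact ⟨⟨h.1.1, hok _ _ _ h.1.2⟩, h.2⟩
  | .ask a b red blue, E, t, h => by
    simp only [check, Bool.and_eq_true] at h ⊢
    exact ⟨⟨h.1.1, check_mono hok red _ _ h.1.2⟩, check_mono hok blue _ _ h.2⟩
  | .force a b x y z w blue, E, t, h => by
    simp only [check, Bool.and_eq_true] at h ⊢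
    exact ⟨h.1, check_mono hok blue _ _ h.2⟩

theorem check_strategy (f : Fam) {r : ℕ} (hr : 0 < r) :
    check (okSmall f r) f.edges 0 (strategy f r) := by
  rcases lt_or_ge r 9 with h | h
  · exact check_small f r hr h
  · exact check_mono (okSmall_of_okLarge h) _ _ _ (check_large f r h)

/-- From a position of the family `f` with a blue path on `m` vertices, Builder wins within
`rounds f r` rounds if `m + r = n`. -/
theorem win_of_pos (k : ℕ) : ∀ (f : Fam) (r m : ℕ) (C : Coloring) (φ : ℕ → ℕ) (P : List ℕ),
    rounds f r ≤ k → m + r = n → Pos C φ P m f.edges → Win n k C := by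
  induction k using Nat.strong_induction_on with
  | _ k ih =>
    intro f r m C φ P hk hmr hC
    refine Win.mono hk ?_
    rcases Nat.eq_zero_or_pos r with rfl | hr
    · exact Win.of_ends (Or.inr (hasPath_of_list hC.nodup hC.chain
        (by have := hC.length; omega))) _
    have hok : ∀ o g t, okSmall f r o g t → t ≤ rounds f r := by
      rintro (_ | f') g t h <;> simp only [okSmall, decide_eq_true_eq] at h <;> omega
    refine win_of_check hok (fun g t h => ?_) (fun f' g t h C φ P hC => ?_) _ _ 0
      (check_strategy f hr) C hC
    · simp only [okSmall, decide_eq_true_eq] at h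
      omega
    · simp only [okSmall, decide_eq_true_eq] at h
      exact ih _ (by omega) f' (r - g) _ C φ P (by omega) (by omega) hC

/-! ### The opening -/

theorem win_emptyCol (hn : 10 ≤ n) : Win n ((7 * n + 4) / 5 - 1) emptyCol := by
  have hA : rounds .A (n - 2) + 1 ≤ (7 * n + 4) / 5 - 1 := by
    rw [rounds_eq _ (by omega), Fam.const]; omega
  have hC : rounds .C (n - 2) + 2 ≤ (7 * n + 4) / 5 - 1 := by
    rw [rounds_eq _ (by omega), Fam.const]; omega
  have hD : rounds .D (n - 4) + 5 ≤ (7 * n + 4) / 5 - 1 := by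
    rw [rounds_eq _ (by omega), Fam.const]; omega
  obtain ⟨K, hK⟩ : ∃ K, (7 * n + 4) / 5 - 1 = K + 5 := ⟨(7 * n + 4) / 5 - 1 - 5, by omega⟩
  rw [hK] at hA hC hD ⊢
  refine Win.select s(0, 1) (by simp) fun C₁ c _ h01 => ?_
  cases c with
  | false =>
    refine win_of_pos (K + 4) .A (n - 2) 2 C₁ id [0, 1] (by omega) (by omega)
      ⟨Function.injective_id, by simp, by simpa using h01, rfl, rfl, ?_, rfl, by simp [Fam.edges]⟩
    intro k hk
    simp at hk
    omega
  | true =>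
  refine Win.select s(1, 2) (by simp) fun C₂ c h₂ h12 => ?_
  replace h01 := h₂ _ _ h01
  cases c with
  | false =>
    refine win_of_pos (K + 3) .C (n - 2) 2 C₂ (Equiv.swap 0 2) [2, 1] (by omega) (by omega)
      ⟨Equiv.injective _, by simp, by simpa [Sym2.eq_swap] using h12, rfl, rfl, ?_, rfl, ?_⟩
    · intro k hk
      by_contra! hk'
      rcases eq_or_ne k 2 with rfl | h2
      · simp at hk
      · rw [Equiv.swap_apply_of_ne_of_ne hk'.1 h2] at hk
        simp at hk
        omega
    · simp only [Fam.edges, List.mem_singleton, forall_eq]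
      rw [Sym2.eq_swap]
      exact h01
  | true =>
  refine Win.select s(0, 3) (by simp) fun C₃ c h₃ h03 => ?_
  replace h01 := h₃ _ _ h01
  replace h12 := h₃ _ _ h12
  cases c with
  | true =>
    exact Win.of_ends (Or.inl (hasPath_of_list (l := [3, 0, 1, 2]) (by simp)
      (by simp [h01, h12, Sym2.eq_swap (a := 3), h03]) le_rfl)) _
  | false =>
  refine Win.select s(3, 2) (by simp) fun C₄ c h₄ h32 => ?_
  replace h01 := h₄ _ _ h01
  replace h12 := h₄ _ _ h12
  replace h03 := h₄ _ _ h03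
  cases c with
  | true =>
    exact Win.of_ends (Or.inl (hasPath_of_list (l := [0, 1, 2, 3]) (by simp)
      (by simp [h01, h12, Sym2.eq_swap (a := 2), h32]) le_rfl)) _
  | false =>
  refine Win.select s(4, 0) (by simp) fun C₅ c h₅ h40 => ?_
  replace h01 := h₅ _ _ h01
  replace h12 := h₅ _ _ h12
  replace h03 := h₅ _ _ h03
  replace h32 := h₅ _ _ h32
  cases c with
  | true =>
    exact Win.of_ends (Or.inl (hasPath_of_list (l := [4, 0, 1, 2]) (by simp)
      (by simp [h01, h12, h40]) le_rfl)) _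
  | false =>
    let φ : ℕ → ℕ
      | 0 => 4
      | 1 => 2
      | 2 => 1
      | 3 => 0
      | k + 4 => k + 5
    refine win_of_pos K .D (n - 4) 4 C₅ φ [4, 0, 3, 2] (by omega) (by omega)
      ⟨?_, by simp, by simp [h40, h03, h32], rfl, rfl, ?_, rfl, ?_⟩
    · rintro (_ | _ | _ | _ | i) (_ | _ | _ | _ | j) hij <;> simp only [φ] at hij <;> omega
    · rintro (_ | _ | _ | _ | k) hk <;> simp [φ] at hk ⊢
    · simp only [Fam.edges, List.mem_cons, List.not_mem_nil, or_false, forall_eq_or_imp, forall_eq]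
      constructor <;> rw [Sym2.eq_swap]
      exacts [h12, h01]

end OSR

/-- **Theorem 2.** For every `n ≥ 10`, `r̃(P_4, P_n) ≤ ⌈7n/5⌉ − 1`. -/
theorem OSR.onlineRamseyPath_four_le (n : ℕ) (hn : 10 ≤ n) :
    (OSR.onlineRamseyPath 4 n : ℤ) ≤ ⌈(7 * n : ℚ) / 5⌉ - 1 := by
  have h := OSR.onlineRamseyPath_le_of_win (OSR.win_emptyCol hn)
  obtain ⟨q, hq, h₁, h₂⟩ : ∃ q, q = (7 * n + 4) / 5 ∧ q * 5 ≤ 7 * n + 4 ∧ 7 * n ≤ q * 5 :=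
    ⟨_, rfl, by omega, by omega⟩
  have hc : ⌈(7 * n : ℚ) / 5⌉ = (q : ℤ) := by
    have h₁' : (q : ℚ) * 5 ≤ 7 * n + 4 := by exact_mod_cast h₁
    have h₂' : (7 * n : ℚ) ≤ q * 5 := by exact_mod_cast h₂
    rw [Int.ceil_eq_iff]
    constructor <;> push_cast <;> linarith
  rw [hc]
  omega
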